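/- Let λ₁, λ₂, λ₃, λ₄ be real numbers with arctan λ₁ + arctan λ₂ + arctan λ₃ + arctan λ₄ ∈ (π, 3π/2). Then σ₁σ₂ > σ₁ + σ₃ > 2σ₁, where σ₁ = Σᵢ λᵢ, σ₂ = Σ_{i<j} λᵢλⱼ, and σ₃ = Σ_{i<j<k} λᵢλⱼλₖ. -/

import Mathlib

open Real

theorem sin_arctan_eq_mul_cos (x : ℝ) : sin (arctan x) = x * cos (arctan x) := by
  have h := tan_mul_cos (cos_arctan_pos x).ne'
  rw [tan_arctan] at h
  exact h.symm

theorem add_pos_of_arctan_add_pos {x y : ℝ} (h : 0 < arctan x + arctan y) : 0 < x + y := by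
  have h' : arctan (-y) < arctan x := by rw [arctan_neg]; linarith
  linarith [arctan_strictMono.lt_iff_lt.1 h']

theorem one_lt_of_pi_div_two_lt_arctan_add {x y z : ℝ}
    (h : π / 2 < arctan x + arctan y + arctan z) : 1 < x * y + x * z + y * z := by
  have hx := arctan_lt_pi_div_two x
  have hy := arctan_lt_pi_div_two y
  have hz := arctan_lt_pi_div_two z
  have hc := cos_neg_of_pi_div_two_lt_of_lt h (by linarith)
  have hcos : cos (arctan x + arctan y + arctan z) =
      cos (arctan x) * cos (arctan y) * cos (arctan z) * (1 - (x * y + x * z + y * z)) := by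
    simp only [cos_add, sin_add, sin_arctan_eq_mul_cos]
    ring
  rw [hcos] at hc
  have hp := mul_pos (mul_pos (cos_arctan_pos x) (cos_arctan_pos y)) (cos_arctan_pos z)
  linarith [(pos_iff_neg_of_mul_neg hc).1 hp]

theorem esymm_one_lt_esymm_three_of_arctan_add_mem {a b c d : ℝ}
    (h : arctan a + arctan b + arctan c + arctan d ∈ Set.Ioo π (3 * π / 2)) :
    a + b + c + d < a * b * c + a * b * d + a * c * d + b * c * d := by
  have hs : sin (arctan a + arctan b + arctan c + arctan d) < 0 := by
    rw [← sin_sub_two_pi]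
    exact sin_neg_of_neg_of_neg_pi_lt (by linarith [h.2, pi_pos]) (by linarith [h.1])
  have hsin : sin (arctan a + arctan b + arctan c + arctan d) =
      cos (arctan a) * cos (arctan b) * cos (arctan c) * cos (arctan d) *
        (a + b + c + d - (a * b * c + a * b * d + a * c * d + b * c * d)) := by
    simp only [cos_add, sin_add, sin_arctan_eq_mul_cos]
    ring
  rw [hsin] at hs
  have hp := mul_pos (mul_pos (mul_pos (cos_arctan_pos a) (cos_arctan_pos b))
    (cos_arctan_pos c)) (cos_arctan_pos d)
  linarith [(pos_iff_neg_of_mul_neg hs).1 hp]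

theorem two_mul_esymm_three_le_of_nonneg {a b c d : ℝ}
    (ha : 0 ≤ a) (hb : 0 ≤ b) (hc : 0 ≤ c) (hd : 0 ≤ d) :
    2 * (a * b * c + a * b * d + a * c * d + b * c * d) ≤
      (a + b + c + d) * (a * b + a * c + a * d + b * c + b * d + c * d) := by
  rw [← sub_nonneg]
  ring_nf
  positivity

theorem two_mul_esymm_three_le_of_nonpos {a b c d : ℝ}
    (ha : a ≤ 0) (hb : 0 ≤ a + b) (hc : 0 ≤ a + c) (hd : 0 ≤ a + d) :
    2 * (a * b * c + a * b * d + a * c * d + b * c * d) ≤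
      (a + b + c + d) * (a * b + a * c + a * d + b * c + b * d + c * d) := by
  obtain ⟨t, rfl⟩ : ∃ t, a = -t := ⟨-a, by ring⟩
  obtain ⟨u, rfl⟩ : ∃ u, b = t + u := ⟨-t + b, by ring⟩
  obtain ⟨v, rfl⟩ : ∃ v, c = t + v := ⟨-t + c, by ring⟩
  obtain ⟨w, rfl⟩ : ∃ w, d = t + w := ⟨-t + d, by ring⟩
  have ht : 0 ≤ t := by linarith
  have hu : 0 ≤ u := by linarith
  have hv : 0 ≤ v := by linarith
  have hw : 0 ≤ w := by linarith
  rw [← sub_nonneg]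
  ring_nf
  positivity

theorem two_mul_esymm_three_le_of_pairwise_add_nonneg {a b c d : ℝ}
    (hab : 0 ≤ a + b) (hac : 0 ≤ a + c) (had : 0 ≤ a + d)
    (hbc : 0 ≤ b + c) (hbd : 0 ≤ b + d) (hcd : 0 ≤ c + d) :
    2 * (a * b * c + a * b * d + a * c * d + b * c * d) ≤
      (a + b + c + d) * (a * b + a * c + a * d + b * c + b * d + c * d) := by
  rcases le_total a 0 with ha | ha
  · exact two_mul_esymm_three_le_of_nonpos ha hab hac had
  rcases le_total b 0 with hb | hb
  · linarith [two_mul_esymm_three_le_of_nonpos hb (by linarith : 0 ≤ b + a) hbc hbd]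
  rcases le_total c 0 with hc | hc
  · linarith [two_mul_esymm_three_le_of_nonpos hc (by linarith : 0 ≤ c + a)
      (by linarith : 0 ≤ c + b) hcd]
  rcases le_total d 0 with hd | hd
  · linarith [two_mul_esymm_three_le_of_nonpos hd (by linarith : 0 ≤ d + a)
      (by linarith : 0 ≤ d + b) (by linarith : 0 ≤ d + c)]
  exact two_mul_esymm_three_le_of_nonneg ha hb hc hd

theorem stmt_9 (l₁ l₂ l₃ l₄ : ℝ)
    (h : arctan l₁ + arctan l₂ + arctan l₃ + arctan l₄ ∈
      Set.Ioo π (3 * π / 2)) :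
    (l₁ + l₂ + l₃ + l₄) *
        (l₁ * l₂ + l₁ * l₃ + l₁ * l₄ + l₂ * l₃ + l₂ * l₄ + l₃ * l₄) >
      (l₁ + l₂ + l₃ + l₄) +
        (l₁ * l₂ * l₃ + l₁ * l₂ * l₄ + l₁ * l₃ * l₄ + l₂ * l₃ * l₄) ∧
    (l₁ + l₂ + l₃ + l₄) +
        (l₁ * l₂ * l₃ + l₁ * l₂ * l₄ + l₁ * l₃ * l₄ + l₂ * l₃ * l₄) >
      2 * (l₁ + l₂ + l₃ + l₄) := by
  have hσ := esymm_one_lt_esymm_three_of_arctan_add_mem h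
  have hlt := h.1
  have h₁ := arctan_lt_pi_div_two l₁
  have h₂ := arctan_lt_pi_div_two l₂
  have h₃ := arctan_lt_pi_div_two l₃
  have h₄ := arctan_lt_pi_div_two l₄
  have h₁₂ : 0 < l₁ + l₂ := add_pos_of_arctan_add_pos (by linarith)
  have h₁₃ : 0 < l₁ + l₃ := add_pos_of_arctan_add_pos (by linarith)
  have h₁₄ : 0 < l₁ + l₄ := add_pos_of_arctan_add_pos (by linarith)
  have h₂₃ : 0 < l₂ + l₃ := add_pos_of_arctan_add_pos (by linarith)
  have h₂₄ : 0 < l₂ + l₄ := add_pos_of_arctan_add_pos (by linarith)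
  have h₃₄ : 0 < l₃ + l₄ := add_pos_of_arctan_add_pos (by linarith)
  have h₁₂₃ : 1 < l₁ * l₂ + l₁ * l₃ + l₂ * l₃ :=
    one_lt_of_pi_div_two_lt_arctan_add (by linarith)
  have h₁₂₄ : 1 < l₁ * l₂ + l₁ * l₄ + l₂ * l₄ :=
    one_lt_of_pi_div_two_lt_arctan_add (by linarith)
  have h₁₃₄ : 1 < l₁ * l₃ + l₁ * l₄ + l₃ * l₄ :=
    one_lt_of_pi_div_two_lt_arctan_add (by linarith)
  have h₂₃₄ : 1 < l₂ * l₃ + l₂ * l₄ + l₃ * l₄ :=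
    one_lt_of_pi_div_two_lt_arctan_add (by linarith)
  have hσ₁ : 0 < l₁ + l₂ + l₃ + l₄ := by linarith
  have hσ₂ : 2 < l₁ * l₂ + l₁ * l₃ + l₁ * l₄ + l₂ * l₃ + l₂ * l₄ + l₃ * l₄ := by linarith
  have hle := two_mul_esymm_three_le_of_pairwise_add_nonneg
    h₁₂.le h₁₃.le h₁₄.le h₂₃.le h₂₄.le h₃₄.le
  have hmul := mul_lt_mul_of_pos_left hσ₂ hσ₁
  exact ⟨by linarith, by linarith⟩
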